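/- Let Q_0 be a dyadic cube in ℝⁿ and let ε = {ε_Q}_{Q∈𝒟(Q_0)} be a collection of positive real numbers indexed by the dyadic subcubes of Q_0, bounded above and with the domination property. If p is an exponent function on Q_0 with 1 < p_- ≤ p_+ < ∞ and p ∈ εLH_0(Q_0), then there exists a constant C = C(n, p(·), ε, Q_0) such that ‖M_ε f‖_{L^{p(·)}(Q_0)} ≤ C‖f‖_{L^{p(·)}(Q_0)} for all f ∈ L^{p(·)}(Q_0). -/

import Mathlib

open MeasureTheory Set ENNReal

noncomputable section

/-- The dyadic cube in `ℝⁿ` with side length `2^(-k)` and lower-left corner `2^(-k) • m`. -/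
def dyadicCube (n : ℕ) (k : ℤ) (m : Fin n → ℤ) : Set (Fin n → ℝ) :=
  {x | ∀ i, (2 : ℝ) ^ (-k) * m i ≤ x i ∧ x i < (2 : ℝ) ^ (-k) * (m i + 1)}

/-- `Q` is a dyadic cube in `ℝⁿ`. -/
def IsDyadicCube (n : ℕ) (Q : Set (Fin n → ℝ)) : Prop :=
  ∃ (k : ℤ) (m : Fin n → ℤ), Q = dyadicCube n k m

/-- `ε_Q` times the average of `|f|` over `Q`. -/
def epsAvg (n : ℕ) (ε : Set (Fin n → ℝ) → ℝ) (f : (Fin n → ℝ) → ℝ)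
    (Q : Set (Fin n → ℝ)) : ℝ :=
  ε Q * (((volume Q).toReal)⁻¹ * ∫ y in Q, |f y| ∂volume)

/-- The local ε-maximal operator on `Q₀`:
`M_ε f (x) = sup_{Q ∈ 𝒟(Q₀), x ∈ Q} ε_Q ⨍_Q |f|`. -/
def epsMaxOn (n : ℕ) (Q₀ : Set (Fin n → ℝ)) (ε : Set (Fin n → ℝ) → ℝ)
    (f : (Fin n → ℝ) → ℝ) (x : Fin n → ℝ) : ℝ :=
  sSup {r : ℝ | ∃ Q, IsDyadicCube n Q ∧ Q ⊆ Q₀ ∧ x ∈ Q ∧ r = epsAvg n ε f Q}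

/-- The variable Lebesgue norm `‖f‖_{p(·)}` (valued in `ℝ≥0∞`; it is `∞` iff
`f ∉ L^{p(·)}`). -/
def varLpNorm {α : Type*} [MeasurableSpace α] (p : α → ℝ) (μ : Measure α)
    (f : α → ℝ) : ℝ≥0∞ :=
  sInf {l : ℝ≥0∞ | ∃ r : ℝ, 0 < r ∧ l = ENNReal.ofReal r ∧
    ∫⁻ x, ENNReal.ofReal ((|f x| / r) ^ p x) ∂μ ≤ 1}

/-- Membership in the variable Lebesgue space `L^{p(·)}`. -/
def MemVarLp {α : Type*} [MeasurableSpace α] (p : α → ℝ) (μ : Measure α)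
    (f : α → ℝ) : Prop :=
  varLpNorm p μ f < ⊤

section Laminar

variable {α ι : Type*} [MeasurableSpace α] {μ : Measure α} {Q : ι → Set α}

/-- The maximal function of `g` over the family of sets `Q`. -/
def familyMax (μ : Measure α) (Q : ι → Set α) (g : α → ℝ≥0∞) (x : α) : ℝ≥0∞ :=
  ⨆ i, (Q i).indicator (fun _ => ⨍⁻ y in Q i, g y ∂μ) x

lemma measurable_familyMax [Countable ι] (hQ : ∀ i, MeasurableSet (Q i)) (g : α → ℝ≥0∞) :
    Measurable (familyMax μ Q g) :=
  .iSup fun i => measurable_const.indicator (hQ i)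

lemma laverage_le_familyMax (g : α → ℝ≥0∞) {i : ι} {x : α} (hx : x ∈ Q i) :
    ⨍⁻ y in Q i, g y ∂μ ≤ familyMax μ Q g x := by
  refine le_trans ?_ (le_iSup _ i)
  rw [indicator_of_mem hx]

/-- A family of sets any two of which are nested or disjoint. -/
def IsLaminar (Q : ι → Set α) : Prop :=
  ∀ i j, Disjoint (Q i) (Q j) ∨ Q i ⊆ Q j ∨ Q j ⊆ Q i

lemma IsLaminar.mul_measure_biUnion_finset_le (hL : IsLaminar Q)
    (hQ : ∀ i, MeasurableSet (Q i)) (ν : Measure α) (c : ℝ≥0∞)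
    (h : ∀ i, c * μ (Q i) ≤ ν (Q i)) (s : Finset ι) :
    c * μ (⋃ i ∈ s, Q i) ≤ ν (⋃ i ∈ s, Q i) := by
  classical
  set F : Finset (Set α) := s.image Q
  set F' : Finset (Set α) := F.filter (fun A => Maximal (· ∈ F) A)
  have hU : (⋃ i ∈ s, Q i) = ⋃ A ∈ F', A := by
    apply subset_antisymm
    · refine iUnion₂_subset fun i hi => ?_
      obtain ⟨A, hA, hmax⟩ := F.exists_le_maximal (Finset.mem_image_of_mem Q hi)
      exact subset_trans hA
        (subset_biUnion_of_mem (u := id) (Finset.mem_filter.2 ⟨hmax.prop, hmax⟩))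
    · refine iUnion₂_subset fun A hA => ?_
      obtain ⟨i, hi, rfl⟩ := Finset.mem_image.1 (Finset.mem_filter.1 hA).1
      exact subset_biUnion_of_mem (u := Q) hi
  have hF' : ∀ A ∈ F', ∃ i, Q i = A := fun A hA => by
    obtain ⟨i, -, rfl⟩ := Finset.mem_image.1 (Finset.mem_filter.1 hA).1
    exact ⟨i, rfl⟩
  have hd : Set.PairwiseDisjoint (F' : Set (Set α)) id := by
    intro A hA B hB hAB
    have hA' := (Finset.mem_filter.1 hA)
    have hB' := (Finset.mem_filter.1 hB)
    obtain ⟨i, rfl⟩ := hF' A hA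
    obtain ⟨j, rfl⟩ := hF' B hB
    rcases hL i j with h | h | h
    · exact h
    · exact absurd (hA'.2.eq_of_le hB'.1 h) hAB
    · exact absurd (hB'.2.eq_of_le hA'.1 h).symm hAB
  have hm : ∀ A ∈ F', MeasurableSet (id A) := fun A hA => by
    obtain ⟨i, rfl⟩ := hF' A hA
    exact hQ i
  have e (κ : Measure α) : κ (⋃ A ∈ F', A) = ∑ A ∈ F', κ A := measure_biUnion_finset hd hm
  rw [hU, e, e, Finset.mul_sum]
  refine Finset.sum_le_sum fun A hA => ?_
  obtain ⟨i, rfl⟩ := hF' A hA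
  exact h i

lemma IsLaminar.mul_measure_iUnion_le [Countable ι] (hL : IsLaminar Q)
    (hQ : ∀ i, MeasurableSet (Q i)) (ν : Measure α) (c : ℝ≥0∞)
    (h : ∀ i, c * μ (Q i) ≤ ν (Q i)) :
    c * μ (⋃ i, Q i) ≤ ν (⋃ i, Q i) := by
  rw [iUnion_eq_iUnion_finset, Directed.measure_iUnion, ENNReal.mul_iSup]
  · refine iSup_le fun s => (hL.mul_measure_biUnion_finset_le hQ ν c h s).trans ?_
    exact measure_mono (subset_iUnion (fun s : Finset ι => ⋃ i ∈ s, Q i) s)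
  · exact Monotone.directed_le fun s t hst => biUnion_subset_biUnion_left hst

/-- Weak type estimate: only the part of `g` above `t / 2` contributes. -/
lemma IsLaminar.mul_measure_lt_familyMax_le [Countable ι] (hL : IsLaminar Q)
    (hQ : ∀ i, MeasurableSet (Q i)) (hfin : ∀ i, μ (Q i) ≠ ∞) {g : α → ℝ} (hg : Measurable g)
    {t : ℝ} (ht : 0 < t) :
    ENNReal.ofReal t * μ {x | ENNReal.ofReal t < familyMax μ Q (fun x => ENNReal.ofReal (g x)) x}
      ≤ 2 * (μ.withDensity fun x => ENNReal.ofReal (g x)) {x | t < 2 * g x} := by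
  set G : α → ℝ≥0∞ := fun x => ENNReal.ofReal (g x)
  have hG : Measurable G := hg.ennreal_ofReal
  have hS : MeasurableSet {x | t < 2 * g x} := measurableSet_lt measurable_const (by fun_prop)
  set J : Set ι := {i | ENNReal.ofReal t < ⨍⁻ y in Q i, G y ∂μ}
  set ν : Measure α := (2 : ℝ≥0∞) • (μ.withDensity G).restrict {x | t < 2 * g x}
  have hsub : {x | ENNReal.ofReal t < familyMax μ Q G x} ⊆ ⋃ i : J, Q i := by
    intro x hx
    obtain ⟨i, hi⟩ := lt_iSup_iff.1 hx.out
    by_cases hxi : x ∈ Q i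
    · rw [indicator_of_mem hxi] at hi
      exact mem_iUnion.2 ⟨⟨i, hi⟩, hxi⟩
    · rw [indicator_of_notMem hxi] at hi
      exact absurd hi _root_.not_lt_zero
  have hJ : IsLaminar fun i : J => Q i := fun i j => hL i j
  have key : ∀ i : J, ENNReal.ofReal t * μ (Q i) ≤ ν (Q i) := by
    rintro ⟨i, hi⟩
    have hi' : ENNReal.ofReal t * μ (Q i) ≤ ∫⁻ y in Q i, G y ∂μ := by
      have := hi.out.le
      rw [setLAverage_eq] at this
      exact ENNReal.mul_le_of_le_div this
    have hsplit : ∫⁻ y in Q i, G y ∂μ ≤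
        ENNReal.ofReal (t / 2) * μ (Q i) + (μ.withDensity G) (Q i ∩ {x | t < 2 * g x}) := by
      rw [withDensity_apply _ ((hQ i).inter hS), inter_comm,
        ← Measure.restrict_restrict hS, ← lintegral_indicator hS, ← setLIntegral_const,
        ← lintegral_add_left measurable_const]
      refine lintegral_mono fun y => ?_
      by_cases hy : y ∈ {x | t < 2 * g x}
      · rw [indicator_of_mem hy]; exact le_add_self
      · rw [indicator_of_notMem hy, add_zero]
        simp only [mem_ofPred_eq, not_lt] at hy
        exact ENNReal.ofReal_le_ofReal (by linarith)
    have hhalf : ENNReal.ofReal t * μ (Q i) =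
        ENNReal.ofReal (t / 2) * μ (Q i) + ENNReal.ofReal (t / 2) * μ (Q i) := by
      rw [← add_mul, ← ENNReal.ofReal_add (by positivity) (by positivity), add_halves]
    have h2 : ENNReal.ofReal (t / 2) * μ (Q i) ≤
        (μ.withDensity G) (Q i ∩ {x | t < 2 * g x}) := by
      rw [hhalf] at hi'
      exact (ENNReal.add_le_add_iff_left (ENNReal.mul_ne_top ENNReal.ofReal_ne_top (hfin i))).1
        (hi'.trans hsplit)
    simp only [ν, Measure.smul_apply, smul_eq_mul, Measure.restrict_apply (hQ i)]
    rw [hhalf, ← two_mul]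
    gcongr
  calc _ ≤ ENNReal.ofReal t * μ (⋃ i : J, Q i) := by gcongr
    _ ≤ ν (⋃ i : J, Q i) := hJ.mul_measure_iUnion_le (fun i => hQ i) ν _ key
    _ ≤ ν univ := measure_mono (subset_univ _)
    _ = _ := by simp [ν]

lemma IsLaminar.familyMax_lt_top_ae [Countable ι] (hL : IsLaminar Q)
    (hQ : ∀ i, MeasurableSet (Q i)) (hfin : ∀ i, μ (Q i) ≠ ∞) {g : α → ℝ} (hg : Measurable g)
    (hgi : ∫⁻ x, ENNReal.ofReal (g x) ∂μ ≠ ∞) :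
    ∀ᵐ x ∂μ, familyMax μ Q (fun x => ENNReal.ofReal (g x)) x < ∞ := by
  set M := familyMax μ Q (fun x => ENNReal.ofReal (g x))
  set I := ∫⁻ x, ENNReal.ofReal (g x) ∂μ
  have key (k : ℕ) : (k : ℝ≥0∞) * μ {x | ¬ M x < ∞} ≤ 2 * I := by
    rcases Nat.eq_zero_or_pos k with rfl | hk
    · simp
    have hk' : (0 : ℝ) < k := by exact_mod_cast hk
    have := hL.mul_measure_lt_familyMax_le hQ hfin hg hk'
    rw [ENNReal.ofReal_natCast] at this
    calc _ ≤ (k : ℝ≥0∞) * μ {x | (k : ℝ≥0∞) < M x} := by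
          gcongr with x
          intro hx
          rw [not_lt_top_iff.1 hx]
          exact ENNReal.natCast_lt_top k
      _ ≤ _ := this
      _ ≤ _ := by
        gcongr
        refine (measure_mono (subset_univ _)).trans ?_
        rw [withDensity_apply _ .univ, Measure.restrict_univ]
  rw [ae_iff]
  by_contra h0
  have htop : 2 * I / μ {x | ¬ M x < ∞} ≠ ∞ :=
    ENNReal.div_ne_top (ENNReal.mul_ne_top (by simp) hgi) h0
  obtain ⟨k, hk⟩ := ENNReal.exists_nat_gt htop
  by_cases hinf : μ {x | ¬ M x < ∞} = ∞
  · have := key 1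
    rw [hinf] at this
    simp only [Nat.cast_one, one_mul, top_le_iff] at this
    exact ENNReal.mul_ne_top (by simp) hgi this
  · exact absurd (key k) (not_le.2 ((ENNReal.div_lt_iff (.inl h0) (.inl hinf)).1 hk))

/-- Strong type estimate for the maximal function over a countable laminar family. -/
lemma IsLaminar.lintegral_familyMax_rpow_le [Countable ι] (hL : IsLaminar Q)
    (hQ : ∀ i, MeasurableSet (Q i)) (hfin : ∀ i, μ (Q i) ≠ ∞) {g : α → ℝ} (hg : Measurable g)
    (hg0 : ∀ x, 0 ≤ g x) (hgi : ∫⁻ x, ENNReal.ofReal (g x) ∂μ ≠ ∞) {r : ℝ} (hr : 1 < r) :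
    ∫⁻ x, familyMax μ Q (fun x => ENNReal.ofReal (g x)) x ^ r ∂μ ≤
      ENNReal.ofReal (r * 2 ^ r / (r - 1)) * ∫⁻ x, ENNReal.ofReal (g x ^ r) ∂μ := by
  set M := familyMax μ Q (fun x => ENNReal.ofReal (g x))
  have hMm : Measurable M := measurable_familyMax hQ _
  set ν := μ.withDensity fun x => ENNReal.ofReal (g x)
  have hr0 : 0 < r := by linarith
  have hr1 : 0 < r - 1 := by linarith
  have e1 : ∫⁻ x, M x ^ r ∂μ = ∫⁻ x, ENNReal.ofReal ((M x).toReal ^ r) ∂μ := by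
    refine lintegral_congr_ae ?_
    filter_upwards [hL.familyMax_lt_top_ae hQ hfin hg hgi] with x hx
    rw [← ENNReal.ofReal_rpow_of_nonneg ENNReal.toReal_nonneg hr0.le, ENNReal.ofReal_toReal hx.ne]
  have e2 : ∫⁻ x, ENNReal.ofReal ((2 * g x) ^ (r - 1)) ∂ν =
      ENNReal.ofReal (2 ^ (r - 1)) * ∫⁻ x, ENNReal.ofReal (g x ^ r) ∂μ := by
    rw [lintegral_withDensity_eq_lintegral_mul _ hg.ennreal_ofReal (by fun_prop),
      ← lintegral_const_mul _ (by fun_prop)]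
    refine lintegral_congr fun x => ?_
    rw [Pi.mul_apply, ← ENNReal.ofReal_mul (hg0 x), ← ENNReal.ofReal_mul (by positivity),
      Real.mul_rpow zero_le_two (hg0 x)]
    congr 1
    rw [mul_left_comm, ← Real.rpow_one_add' (hg0 x) (by linarith), add_sub_cancel]
  have e3 := lintegral_rpow_eq_lintegral_meas_lt_mul ν (f := fun x => 2 * g x)
    (Filter.Eventually.of_forall fun x => by have := hg0 x; simp only [Pi.zero_apply]; positivity)
    (by fun_prop) hr1
  rw [e1, lintegral_rpow_eq_lintegral_meas_lt_mul μ
    (Filter.Eventually.of_forall fun x => ENNReal.toReal_nonneg) (by fun_prop) hr0]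
  calc _ ≤ ENNReal.ofReal r * ∫⁻ t in Ioi 0, 2 *
        (ν {x | t < 2 * g x} * ENNReal.ofReal (t ^ (r - 1 - 1))) := by
        gcongr ENNReal.ofReal r * ?_
        refine setLIntegral_mono' measurableSet_Ioi fun t (ht : 0 < t) => ?_
        have hpow : t ^ (r - 1) = t * t ^ (r - 1 - 1) := by
          rw [← Real.rpow_one_add' ht.le (by linarith), add_sub_cancel]
        rw [hpow, ENNReal.ofReal_mul ht.le, ← mul_assoc, ← mul_assoc, mul_comm (μ _)]
        gcongr ?_ * _
        refine le_trans ?_ (hL.mul_measure_lt_familyMax_le hQ hfin hg ht)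
        gcongr with x
        intro hx
        change ENNReal.ofReal t < M x
        rcases eq_or_ne (M x) ∞ with h | h
        · rw [h]; exact ENNReal.ofReal_lt_top
        · exact (ENNReal.ofReal_lt_iff_lt_toReal ht.le h).2 hx
    _ = ENNReal.ofReal (2 * r / (r - 1)) * ∫⁻ x, ENNReal.ofReal ((2 * g x) ^ (r - 1)) ∂ν := by
        rw [e3, lintegral_const_mul' _ _ (by simp), ← mul_assoc, ← mul_assoc,
          ← ENNReal.ofReal_mul (by positivity), div_mul_cancel₀ _ hr1.ne', mul_comm 2 r,
          ENNReal.ofReal_mul hr0.le]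
        simp
    _ = _ := by
        rw [e2, ← mul_assoc, ← ENNReal.ofReal_mul (by positivity)]
        congr 2
        rw [Real.rpow_sub_one two_ne_zero]
        field_simp

end Laminar

section Averages

variable {α : Type*} [MeasurableSpace α] {μ : Measure α} {Q : Set α}

/-- Jensen's inequality for powers of set averages. -/
lemma setLAverage_rpow_le (h0 : μ Q ≠ 0) (hfin : μ Q ≠ ∞) {u : α → ℝ≥0∞} (hu : Measurable u)
    {a : ℝ} (ha : 1 ≤ a) :
    (⨍⁻ y in Q, u y ∂μ) ^ a ≤ ⨍⁻ y in Q, u y ^ a ∂μ := by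
  have : IsProbabilityMeasure ((μ Q)⁻¹ • μ.restrict Q) :=
    ⟨by simp [ENNReal.inv_mul_cancel h0 hfin]⟩
  have ha0 : 0 < a := by linarith
  have h := eLpNorm'_le_eLpNorm'_of_exponent_le one_pos ha ((μ Q)⁻¹ • μ.restrict Q)
    hu.aestronglyMeasurable
  simp only [eLpNorm', enorm_eq_self, ENNReal.rpow_one, div_one, one_div] at h
  rw [setLAverage_eq', setLAverage_eq']
  exact (ENNReal.le_rpow_inv_iff ha0).1 h

/-- Pointwise comparison of a weighted average at variable exponent with an average at constant
exponent, in terms of the local log-Hölder type quantity `(e / μ Q) ^ (s - q)`. -/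
lemma mul_setLAverage_rpow_le (h0 : μ Q ≠ 0) (hfin : μ Q ≠ ∞)
    {u : α → ℝ≥0∞} (hu : Measurable u) (hu1 : ∀ y, 1 ≤ u y) {p : α → ℝ} {r q s t P : ℝ}
    (hr : 1 ≤ r) (hrq : r ≤ q) (hqp : ∀ᵐ y ∂μ.restrict Q, q ≤ p y) (hqt : q ≤ t) (hts : t ≤ s)
    (htP : t ≤ P) {L B e D : ℝ≥0∞} (hL : 1 ≤ L) (hB : 1 ≤ B) (heB : e ≤ B)
    (hint : ∫⁻ y in Q, u y ^ p y ∂μ ≤ L) (hD : (e / μ Q) ^ (s - q) ≤ D) :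
    (e * ⨍⁻ y in Q, u y ∂μ) ^ t ≤
      B ^ P * ((B ^ P * L) ^ P * max 1 D) * (⨍⁻ y in Q, u y ^ (p y / r) ∂μ) ^ r := by
  have hr0 : 0 < r := by linarith
  have hq0 : 0 < q := by linarith
  have hP : 1 ≤ P := by linarith
  set m := ⨍⁻ y in Q, u y ∂μ
  have hBP : 1 ≤ B ^ P := ENNReal.one_le_rpow hB (by linarith)
  have h1 : m ^ q ≤ L / μ Q := by
    refine (setLAverage_rpow_le h0 hfin hu (hr.trans hrq)).trans ?_
    rw [setLAverage_eq]
    gcongr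
    refine le_trans (lintegral_mono_ae ?_) hint
    filter_upwards [hqp] with y hy using ENNReal.rpow_le_rpow_of_exponent_le (hu1 y) hy
  have h2 : m ^ q ≤ (⨍⁻ y in Q, u y ^ (p y / r) ∂μ) ^ r := by
    have : m ^ q = (m ^ (q / r)) ^ r := by
      rw [← ENNReal.rpow_mul, div_mul_cancel₀ _ hr0.ne']
    rw [this]
    refine ENNReal.rpow_le_rpow ?_ hr0.le
    refine (setLAverage_rpow_le h0 hfin hu ((one_le_div hr0).2 hrq)).trans ?_
    refine laverage_mono_ae ?_
    filter_upwards [hqp] with y hy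
    exact ENNReal.rpow_le_rpow_of_exponent_le (hu1 y) (by gcongr)
  have h3 : (e * m) ^ q ≤ B ^ P * (⨍⁻ y in Q, u y ^ (p y / r) ∂μ) ^ r := by
    rw [ENNReal.mul_rpow_of_nonneg _ _ hq0.le]
    gcongr
    exact (ENNReal.rpow_le_rpow heB hq0.le).trans
      (ENNReal.rpow_le_rpow_of_exponent_le hB (hqt.trans htP))
  have h4 : (e * m) ^ q ≤ (B ^ P * L) * max 1 (e / μ Q) := by
    have he : e ^ q ≤ B ^ P * e := by
      have : e ^ q = e ^ (q - 1) * e ^ (1 : ℝ) := by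
        rw [← ENNReal.rpow_add_of_nonneg _ _ (by linarith) zero_le_one, sub_add_cancel]
      rw [this, ENNReal.rpow_one]
      gcongr
      exact (ENNReal.rpow_le_rpow heB (by linarith)).trans
        (ENNReal.rpow_le_rpow_of_exponent_le hB (by linarith))
    calc (e * m) ^ q = e ^ q * m ^ q := ENNReal.mul_rpow_of_nonneg _ _ hq0.le
      _ ≤ (B ^ P * e) * (L / μ Q) := by gcongr
      _ = (B ^ P * L) * (e / μ Q) := by simp only [div_eq_mul_inv]; ring
      _ ≤ _ := by gcongr; exact le_max_right _ _
  have hK : 1 ≤ B ^ P * L := one_le_mul hBP hL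
  have h5 : (e * m) ^ (t - q) ≤ (B ^ P * L) ^ P * max 1 D := by
    have : (e * m) ^ (t - q) = ((e * m) ^ q) ^ ((t - q) / q) := by
      rw [← ENNReal.rpow_mul, mul_div_cancel₀ _ hq0.ne']
    rw [this]
    calc _ ≤ ((B ^ P * L) * max 1 (e / μ Q)) ^ ((t - q) / q) :=
          ENNReal.rpow_le_rpow h4 (div_nonneg (by linarith) hq0.le)
      _ ≤ ((B ^ P * L) * max 1 (e / μ Q)) ^ (t - q) :=
          ENNReal.rpow_le_rpow_of_exponent_le (one_le_mul hK (le_max_left _ _))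
            (div_le_self (by linarith) (by linarith))
      _ = (B ^ P * L) ^ (t - q) * max 1 (e / μ Q) ^ (t - q) :=
          ENNReal.mul_rpow_of_nonneg _ _ (by linarith)
      _ ≤ (B ^ P * L) ^ P * max 1 (e / μ Q) ^ (s - q) := by
          exact mul_le_mul' (ENNReal.rpow_le_rpow_of_exponent_le hK (by linarith))
            (ENNReal.rpow_le_rpow_of_exponent_le (le_max_left _ _) (by linarith))
      _ ≤ _ := by
          gcongr
          rcases le_total 1 (e / μ Q) with h | h
          · rw [max_eq_right h]; exact hD.trans (le_max_right _ _)
          · rw [max_eq_left h, ENNReal.one_rpow]; exact le_max_left _ _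
  calc (e * m) ^ t = (e * m) ^ q * (e * m) ^ (t - q) := by
        rw [← ENNReal.rpow_add_of_nonneg _ _ hq0.le (by linarith), add_sub_cancel]
    _ ≤ _ := mul_le_mul' h3 h5
    _ = _ := by ring

end Averages

section Dyadic

lemma dyadicCube_eq_pi (n : ℕ) (k : ℤ) (m : Fin n → ℤ) :
    dyadicCube n k m =
      pi univ fun i => Ico ((2 : ℝ) ^ (-k) * m i) ((2 : ℝ) ^ (-k) * (m i + 1)) := by
  ext x; simp [dyadicCube]

lemma IsDyadicCube.measurableSet {n : ℕ} {Q : Set (Fin n → ℝ)} (hQ : IsDyadicCube n Q) :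
    MeasurableSet Q := by
  obtain ⟨k, m, rfl⟩ := hQ
  rw [dyadicCube_eq_pi]
  exact .univ_pi fun i => measurableSet_Ico

lemma volume_dyadicCube (n : ℕ) (k : ℤ) (m : Fin n → ℤ) :
    volume (dyadicCube n k m) = ENNReal.ofReal ((2 : ℝ) ^ (-k)) ^ n := by
  rw [dyadicCube_eq_pi, Real.volume_pi_Ico]
  simp [mul_add]

lemma IsDyadicCube.volume_ne_top {n : ℕ} {Q : Set (Fin n → ℝ)} (hQ : IsDyadicCube n Q) :
    volume Q ≠ ∞ := by
  obtain ⟨k, m, rfl⟩ := hQ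
  rw [volume_dyadicCube]
  exact ENNReal.pow_ne_top ENNReal.ofReal_ne_top

lemma IsDyadicCube.volume_ne_zero {n : ℕ} {Q : Set (Fin n → ℝ)} (hQ : IsDyadicCube n Q) :
    volume Q ≠ 0 := by
  obtain ⟨k, m, rfl⟩ := hQ
  rw [volume_dyadicCube]
  exact pow_ne_zero _ (ENNReal.ofReal_pos.2 (by positivity)).ne'

lemma countable_isDyadicCube (n : ℕ) : {Q | IsDyadicCube n Q}.Countable := by
  refine (countable_range fun a : ℤ × (Fin n → ℤ) => dyadicCube n a.1 a.2).mono ?_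
  rintro _ ⟨k, m, rfl⟩
  exact ⟨(k, m), rfl⟩

lemma dyadicCube_subset_of_mem {n : ℕ} {k l : ℤ} (hkl : k ≤ l) {m m' : Fin n → ℤ}
    {x : Fin n → ℝ} (hx : x ∈ dyadicCube n k m) (hx' : x ∈ dyadicCube n l m') :
    dyadicCube n l m' ⊆ dyadicCube n k m := by
  obtain ⟨j, rfl⟩ := Int.le.dest hkl
  have hd : (0 : ℝ) < 2 ^ (-(k + j)) := by positivity
  have hscale : (2 : ℝ) ^ (-k) = 2 ^ (-(k + j)) * ((2 ^ j : ℤ) : ℝ) := by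
    push_cast
    rw [← zpow_natCast, ← zpow_add₀ two_ne_zero]
    congr 1
    ring
  intro y hy i
  have h1 := hx i
  have h2 := hx' i
  have h3 := hy i
  rw [hscale] at h1 ⊢
  generalize (2 : ℝ) ^ (-(k + j)) = d at *
  generalize (2 : ℤ) ^ j = N at *
  have a1 : N * m i < m' i + 1 := by
    have : d * (N * m i) < d * (m' i + 1) := by linarith [h1.1, h2.2]
    exact_mod_cast lt_of_mul_lt_mul_left this hd.le
  have a2 : m' i < N * (m i + 1) := by
    have : d * m' i < d * (N * (m i + 1)) := by linarith [h1.2, h2.1]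
    exact_mod_cast lt_of_mul_lt_mul_left this hd.le
  have b1 : (N * m i : ℝ) ≤ m' i := by exact_mod_cast Int.lt_add_one_iff.1 a1
  have b2 : (m' i + 1 : ℝ) ≤ N * (m i + 1) := by exact_mod_cast a2
  constructor
  · calc d * N * m i = d * (N * m i) := by ring
      _ ≤ d * m' i := by gcongr
      _ ≤ _ := h3.1
  · calc _ < d * (m' i + 1) := h3.2
      _ ≤ d * (N * (m i + 1)) := by gcongr
      _ = _ := by ring

lemma IsDyadicCube.disjoint_or_subset {n : ℕ} {P Q : Set (Fin n → ℝ)} (hP : IsDyadicCube n P)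
    (hQ : IsDyadicCube n Q) : Disjoint P Q ∨ P ⊆ Q ∨ Q ⊆ P := by
  obtain ⟨k, m, rfl⟩ := hP
  obtain ⟨l, m', rfl⟩ := hQ
  refine or_iff_not_imp_left.2 fun h => ?_
  obtain ⟨x, hx, hx'⟩ := not_disjoint_iff.1 h
  rcases le_total k l with hkl | hkl
  · exact .inr (dyadicCube_subset_of_mem hkl hx hx')
  · exact .inl (dyadicCube_subset_of_mem hkl hx' hx)

lemma ofReal_integral_le_lintegral {α : Type*} [MeasurableSpace α] {μ : Measure α} {f : α → ℝ}
    (hf : 0 ≤ᵐ[μ] f) : ENNReal.ofReal (∫ x, f x ∂μ) ≤ ∫⁻ x, ENNReal.ofReal (f x) ∂μ := by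
  by_cases h : Integrable f μ
  · exact (ofReal_integral_eq_lintegral_ofReal h hf).le
  · simp [integral_undef h]

lemma ofReal_epsAvg_div_le {n : ℕ} {ε : Set (Fin n → ℝ) → ℝ} {f : (Fin n → ℝ) → ℝ}
    {Q : Set (Fin n → ℝ)} (hε : 0 ≤ ε Q) (hQ : IsDyadicCube n Q) {l : ℝ} (hl : 0 < l) :
    ENNReal.ofReal (epsAvg n ε f Q / l) ≤
      ENNReal.ofReal (ε Q) * ⨍⁻ y in Q, ENNReal.ofReal (|f y| / l) ∂volume := by
  have hv : 0 < (volume Q).toReal := ENNReal.toReal_pos hQ.volume_ne_zero hQ.volume_ne_top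
  have : epsAvg n ε f Q / l = ε Q * ((volume Q).toReal⁻¹ * ∫ y in Q, |f y| / l) := by
    rw [integral_div, epsAvg]; ring
  rw [this, ENNReal.ofReal_mul hε, ENNReal.ofReal_mul (by positivity), ENNReal.ofReal_inv_of_pos hv,
    ENNReal.ofReal_toReal hQ.volume_ne_top, setLAverage_eq, ENNReal.div_eq_inv_mul]
  gcongr
  exact ofReal_integral_le_lintegral (Filter.Eventually.of_forall fun y => by
    simp only [Pi.zero_apply]; positivity)

lemma epsAvg_nonneg {n : ℕ} {ε : Set (Fin n → ℝ) → ℝ} (f : (Fin n → ℝ) → ℝ)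
    {Q : Set (Fin n → ℝ)} (hε : 0 ≤ ε Q) : 0 ≤ epsAvg n ε f Q :=
  mul_nonneg hε (mul_nonneg (by positivity) (integral_nonneg fun _ => abs_nonneg _))

end Dyadic

lemma varLpNorm_le_mul {α : Type*} [MeasurableSpace α] {p : α → ℝ} {μ : Measure α}
    {f g : α → ℝ} {C : ℝ} (hC : 0 < C)
    (h : ∀ l : ℝ, 0 < l → ∫⁻ x, ENNReal.ofReal ((|f x| / l) ^ p x) ∂μ ≤ 1 →
      ∫⁻ x, ENNReal.ofReal ((|g x| / (C * l)) ^ p x) ∂μ ≤ 1) :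
    varLpNorm p μ g ≤ ENNReal.ofReal C * varLpNorm p μ f := by
  rw [mul_comm, ← ENNReal.div_le_iff (ENNReal.ofReal_pos.2 hC).ne' ENNReal.ofReal_ne_top]
  refine le_sInf ?_
  rintro _ ⟨l, hl, rfl, hle⟩
  rw [ENNReal.div_le_iff (ENNReal.ofReal_pos.2 hC).ne' ENNReal.ofReal_ne_top,
    ← ENNReal.ofReal_mul hl.le, mul_comm l]
  exact sInf_le ⟨C * l, by positivity, rfl, h l hl hle⟩

/-- The dyadic subcubes of `Q₀`. -/
abbrev DyadicSubcube (n : ℕ) (Q₀ : Set (Fin n → ℝ)) : Type :=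
  {Q : Set (Fin n → ℝ) // IsDyadicCube n Q ∧ Q ⊆ Q₀}

instance (n : ℕ) (Q₀ : Set (Fin n → ℝ)) : Countable (DyadicSubcube n Q₀) :=
  ((countable_isDyadicCube n).mono fun _ hQ => hQ.1).to_subtype

lemma isLaminar_dyadicSubcube (n : ℕ) (Q₀ : Set (Fin n → ℝ)) :
    IsLaminar fun Q : DyadicSubcube n Q₀ => (Q : Set (Fin n → ℝ)) :=
  fun P Q => P.2.1.disjoint_or_subset Q.2.1

/-- If the weighted averages of `|f| / l` satisfy a pointwise bound at exponent `t`, then so does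
the `ε`-maximal function. -/
lemma ofReal_epsMaxOn_div_rpow_le {n : ℕ} {Q₀ : Set (Fin n → ℝ)} {ε : Set (Fin n → ℝ) → ℝ}
    (hε : ∀ Q, IsDyadicCube n Q → Q ⊆ Q₀ → 0 < ε Q) {f : (Fin n → ℝ) → ℝ} {x : Fin n → ℝ}
    {l t : ℝ} (hl : 0 < l) (ht : 0 < t) {A : ℝ≥0∞}
    (h : ∀ Q : DyadicSubcube n Q₀, x ∈ (Q : Set (Fin n → ℝ)) →
      (ENNReal.ofReal (ε Q) * ⨍⁻ y in (Q : Set (Fin n → ℝ)),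
        ENNReal.ofReal (|f y| / l) ∂volume) ^ t ≤ A) :
    ENNReal.ofReal ((|epsMaxOn n Q₀ ε f x| / l) ^ t) ≤ A := by
  rcases eq_or_ne A ∞ with rfl | hA
  · exact le_top
  have hT : A ^ t⁻¹ ≠ ∞ := ENNReal.rpow_ne_top_of_nonneg (by positivity) hA
  have hnn : 0 ≤ epsMaxOn n Q₀ ε f x := by
    refine Real.sSup_nonneg ?_
    rintro _ ⟨Q, hQ, hQ0, -, rfl⟩
    exact epsAvg_nonneg f (hε Q hQ hQ0).le
  have hle : epsMaxOn n Q₀ ε f x ≤ (A ^ t⁻¹).toReal * l := by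
    refine Real.sSup_le ?_ (by positivity)
    rintro _ ⟨Q, hQ, hQ0, hx, rfl⟩
    rw [← div_le_iff₀ hl]
    refine (ENNReal.ofReal_le_iff_le_toReal hT).1 ?_
    exact (ofReal_epsAvg_div_le (hε Q hQ hQ0).le hQ hl).trans
      ((ENNReal.le_rpow_inv_iff ht).2 (h ⟨Q, hQ, hQ0⟩ hx))
  rw [abs_of_nonneg hnn, ← ENNReal.ofReal_rpow_of_nonneg (by positivity) ht.le,
    ← ENNReal.le_rpow_inv_iff ht, ENNReal.ofReal_le_iff_le_toReal hT, div_le_iff₀ hl]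
  exact hle

lemma ofReal_div_rpow_le_of_rpow_neg_le {v e a C : ℝ} (hv : 0 < v) (he : 0 < e)
    (h : (v / e) ^ (-a) ≤ C) :
    (ENNReal.ofReal e / ENNReal.ofReal v) ^ a ≤ ENNReal.ofReal C := by
  rw [← ENNReal.ofReal_div_of_pos hv, ENNReal.ofReal_rpow_of_pos (by positivity)]
  refine ENNReal.ofReal_le_ofReal (le_of_eq_of_le ?_ h)
  rw [Real.rpow_neg (by positivity), ← Real.inv_rpow (by positivity), inv_div]

/-- Modular form of the boundedness of the `ε`-maximal operator. -/
lemma exists_lintegral_epsMaxOn_le (n : ℕ) (Q₀ : Set (Fin n → ℝ)) (hQ₀ : IsDyadicCube n Q₀)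
    (ε : Set (Fin n → ℝ) → ℝ)
    (hεpos : ∀ Q, IsDyadicCube n Q → Q ⊆ Q₀ → 0 < ε Q)
    (hεbdd : ∃ B : ℝ, ∀ Q, IsDyadicCube n Q → Q ⊆ Q₀ → ε Q ≤ B)
    (p : (Fin n → ℝ) → ℝ) (hpMeas : Measurable p) (hp1 : ∀ x, 1 ≤ p x)
    (hpminus : 1 < essInf p (volume.restrict Q₀))
    (hpplus : ∃ B : ℝ, ∀ᵐ x ∂volume.restrict Q₀, p x ≤ B)
    (hLH0 : ∃ C0 : ℝ, 0 < C0 ∧ ∀ Q, IsDyadicCube n Q → Q ⊆ Q₀ →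
      ((volume Q).toReal / ε Q) ^
        (essInf p (volume.restrict Q) - essSup p (volume.restrict Q)) ≤ C0) :
    ∃ K : ℝ≥0∞, K ≠ ∞ ∧ ∀ f : (Fin n → ℝ) → ℝ, Measurable f → ∀ l : ℝ, 0 < l →
      ∫⁻ x in Q₀, ENNReal.ofReal ((|f x| / l) ^ p x) ≤ 1 →
      ∫⁻ x in Q₀, ENNReal.ofReal ((|epsMaxOn n Q₀ ε f x| / l) ^ p x) ≤ K := by
  obtain ⟨b, hb⟩ := hεbdd
  obtain ⟨P, hP⟩ := hpplus
  obtain ⟨c, hc0, hc⟩ := hLH0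
  set r := essInf p (volume.restrict Q₀)
  have hr0 : 0 < r := by linarith
  set B : ℝ≥0∞ := max 1 (ENNReal.ofReal b)
  set L : ℝ≥0∞ := 1 + volume Q₀
  set D : ℝ≥0∞ := ENNReal.ofReal c
  have hBtop : B ≠ ∞ := by simp [B]
  have hLtop : L ≠ ∞ := by simp [L, hQ₀.volume_ne_top]
  set K₁ : ℝ≥0∞ := B ^ P * ((B ^ P * L) ^ P * max 1 D)
  have hP0 : 0 ≤ P := by
    have : NeZero (volume.restrict Q₀) :=
      ⟨by rw [Ne, Measure.restrict_eq_zero]; exact hQ₀.volume_ne_zero⟩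
    obtain ⟨x, hx⟩ := hP.exists
    linarith [hp1 x]
  have hK₁ : K₁ ≠ ∞ := by
    have h1 : B ^ P ≠ ∞ := ENNReal.rpow_ne_top_of_nonneg hP0 hBtop
    refine ENNReal.mul_ne_top h1 (ENNReal.mul_ne_top
      (ENNReal.rpow_ne_top_of_nonneg hP0 (ENNReal.mul_ne_top h1 hLtop)) ?_)
    simp [D]
  have hbdd (Q : Set (Fin n → ℝ)) :
      Filter.IsBoundedUnder (· ≥ ·) (ae (volume.restrict Q)) p := ⟨1, by simp [hp1]⟩
  have hPQ {Q : Set (Fin n → ℝ)} (hQ : Q ⊆ Q₀) : ∀ᵐ x ∂volume.restrict Q, p x ≤ P :=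
    ae_restrict_of_ae_restrict_of_subset hQ hP
  have hinf (Q : Set (Fin n → ℝ)) : ∀ᵐ x ∂volume.restrict Q, essInf p (volume.restrict Q) ≤ p x :=
    ae_essInf_le (hbdd Q)
  have hsup {Q : Set (Fin n → ℝ)} (hQ : Q ⊆ Q₀) :
      ∀ᵐ x ∂volume.restrict Q, p x ≤ essSup p (volume.restrict Q) := ae_le_essSup ⟨P, hPQ hQ⟩
  have hrq (Q : DyadicSubcube n Q₀) : r ≤ essInf p (volume.restrict Q) := by
    have : NeZero (volume.restrict (Q : Set (Fin n → ℝ))) :=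
      ⟨by rw [Ne, Measure.restrict_eq_zero]; exact Q.2.1.volume_ne_zero⟩
    refine essInf_antitone_measure (Measure.restrict_mono_set _ Q.2.2).absolutelyContinuous
      (hbdd Q₀) ?_
    exact Filter.IsBoundedUnder.isCoboundedUnder_ge ⟨P, hPQ Q.2.2⟩
  have hloc : ∀ᵐ x ∂volume.restrict Q₀, ∀ Q : DyadicSubcube n Q₀, x ∈ (Q : Set (Fin n → ℝ)) →
      essInf p (volume.restrict Q) ≤ p x ∧ p x ≤ essSup p (volume.restrict Q) := by
    refine ae_restrict_of_ae (ae_all_iff.2 fun Q => ?_)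
    rw [← ae_restrict_iff' Q.2.1.measurableSet]
    exact (hinf Q).and (hsup Q.2.2)
  refine ⟨K₁ * (ENNReal.ofReal (r * 2 ^ r / (r - 1)) * L),
    ENNReal.mul_ne_top hK₁ (ENNReal.mul_ne_top ENNReal.ofReal_ne_top hLtop), ?_⟩
  intro f hf l hl hfl
  set G : (Fin n → ℝ) → ℝ := fun x => max 1 (|f x| / l) with hG
  have hGm : Measurable G := by fun_prop
  have hG1 (x) : 1 ≤ G x := le_max_left _ _
  have hG0 (x) : 0 ≤ G x := zero_le_one.trans (hG1 x)
  have hGint : ∫⁻ x in Q₀, ENNReal.ofReal (G x ^ p x) ≤ L := by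
    calc _ ≤ ∫⁻ x in Q₀, (ENNReal.ofReal ((|f x| / l) ^ p x) + 1) := by
          refine lintegral_mono fun x => ?_
          simp only [hG]
          rcases le_total 1 (|f x| / l) with h | h
          · rw [max_eq_right h]; exact le_self_add
          · rw [max_eq_left h, Real.one_rpow, ENNReal.ofReal_one]; exact le_add_self
      _ = (∫⁻ x in Q₀, ENNReal.ofReal ((|f x| / l) ^ p x)) + volume Q₀ := by
          rw [lintegral_add_right _ measurable_const, setLIntegral_one]
      _ ≤ _ := add_le_add hfl le_rfl
  set u : (Fin n → ℝ) → ℝ≥0∞ := fun x => ENNReal.ofReal (G x)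
  have hu1 (x) : 1 ≤ u x := ENNReal.one_le_ofReal.2 (hG1 x)
  have hupow (x) (a : ℝ) : u x ^ a = ENNReal.ofReal (G x ^ a) :=
    ENNReal.ofReal_rpow_of_pos (by linarith [hG1 x])
  set g : (Fin n → ℝ) → ℝ := fun x => G x ^ (p x / r)
  have hgm : Measurable g := by fun_prop
  have hgr (x) : g x ^ r = G x ^ p x := by
    rw [← Real.rpow_mul (hG0 x), div_mul_cancel₀ _ hr0.ne']
  have hgint : ∫⁻ x in Q₀, ENNReal.ofReal (g x) ≠ ∞ := by
    refine ne_top_of_le_ne_top hLtop (le_trans (lintegral_mono fun x => ?_) hGint)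
    refine ENNReal.ofReal_le_ofReal (Real.rpow_le_rpow_of_exponent_le (hG1 x) ?_)
    exact div_le_self (by linarith [hp1 x]) hpminus.le
  set M : (Fin n → ℝ) → ℝ≥0∞ := familyMax (volume.restrict Q₀)
    (fun Q : DyadicSubcube n Q₀ => (Q : Set (Fin n → ℝ))) fun x => ENNReal.ofReal (g x)
  have hpoint : ∀ᵐ x ∂volume.restrict Q₀,
      ENNReal.ofReal ((|epsMaxOn n Q₀ ε f x| / l) ^ p x) ≤ K₁ * M x ^ r := by
    filter_upwards [hloc, hP] with x hx hxP
    refine ofReal_epsMaxOn_div_rpow_le hεpos hl (by linarith [hp1 x]) fun Q hxQ => ?_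
    have hM : ⨍⁻ y in (Q : Set (Fin n → ℝ)), u y ^ (p y / r) ∂volume ≤ M x := by
      have := laverage_le_familyMax (μ := volume.restrict Q₀)
        (Q := fun Q : DyadicSubcube n Q₀ => (Q : Set (Fin n → ℝ)))
        (fun x => ENNReal.ofReal (g x)) hxQ
      rw [Measure.restrict_restrict_of_subset Q.2.2] at this
      simpa only [hupow] using this
    have hv : 0 < (volume (Q : Set (Fin n → ℝ))).toReal :=
      ENNReal.toReal_pos Q.2.1.volume_ne_zero Q.2.1.volume_ne_top
    have hD : (ENNReal.ofReal (ε Q) / volume (Q : Set (Fin n → ℝ))) ^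
        (essSup p (volume.restrict Q) - essInf p (volume.restrict Q)) ≤ D := by
      rw [← ENNReal.ofReal_toReal Q.2.1.volume_ne_top]
      refine ofReal_div_rpow_le_of_rpow_neg_le hv (hεpos Q Q.2.1 Q.2.2) ?_
      rw [neg_sub]
      exact hc Q Q.2.1 Q.2.2
    have hint : ∫⁻ y in (Q : Set (Fin n → ℝ)), u y ^ p y ≤ L := by
      simp only [hupow]
      exact (lintegral_mono_set Q.2.2).trans hGint
    calc _ ≤ (ENNReal.ofReal (ε Q) * ⨍⁻ y in (Q : Set (Fin n → ℝ)), u y ∂volume) ^ p x := by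
          refine ENNReal.rpow_le_rpow ?_ (by linarith [hp1 x])
          gcongr
          exact Filter.Eventually.of_forall fun y => ENNReal.ofReal_le_ofReal (le_max_right _ _)
      _ ≤ K₁ * (⨍⁻ y in (Q : Set (Fin n → ℝ)), u y ^ (p y / r) ∂volume) ^ r :=
          mul_setLAverage_rpow_le Q.2.1.volume_ne_zero Q.2.1.volume_ne_top
            hGm.ennreal_ofReal hu1 hpminus.le (hrq Q) (hinf Q) (hx Q hxQ).1 (hx Q hxQ).2 hxP
            le_self_add (le_max_left _ _)
            ((ENNReal.ofReal_le_ofReal (hb Q Q.2.1 Q.2.2)).trans (le_max_right _ _)) hint hD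
      _ ≤ K₁ * M x ^ r := by gcongr
  calc _ ≤ ∫⁻ x in Q₀, K₁ * M x ^ r := lintegral_mono_ae hpoint
    _ = K₁ * ∫⁻ x in Q₀, M x ^ r := lintegral_const_mul' _ _ hK₁
    _ ≤ K₁ * (ENNReal.ofReal (r * 2 ^ r / (r - 1)) *
          ∫⁻ x in Q₀, ENNReal.ofReal (g x ^ r)) := by
        gcongr
        refine (isLaminar_dyadicSubcube n Q₀).lintegral_familyMax_rpow_le
          (fun Q => Q.2.1.measurableSet) (fun Q => ?_) hgm
          (fun x => Real.rpow_nonneg (hG0 x) _) hgint hpminus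
        exact ne_top_of_le_ne_top Q.2.1.volume_ne_top (Measure.restrict_apply_le _ _)
    _ ≤ _ := by
        simp only [hgr]
        gcongr

/-- **Lemma 3.1 (local boundedness of the ε-maximal operator).**
Let `Q₀` be a dyadic cube and `ε = {ε_Q}_{Q ∈ 𝒟(Q₀)}` a bounded collection of
positive numbers with the domination property. If `p ∈ εLH_0(Q₀)` with
`1 < p_- ≤ p_+ < ∞`, then `M_ε` is bounded on `L^{p(·)}(Q₀)`. -/
theorem epsMaxOn_bounded (n : ℕ) (Q₀ : Set (Fin n → ℝ)) (hQ₀ : IsDyadicCube n Q₀)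
    (ε : Set (Fin n → ℝ) → ℝ)
    (hεpos : ∀ Q, IsDyadicCube n Q → Q ⊆ Q₀ → 0 < ε Q)
    (hεbdd : ∃ B : ℝ, ∀ Q, IsDyadicCube n Q → Q ⊆ Q₀ → ε Q ≤ B)
    (hεdom : ∀ P Q, IsDyadicCube n P → IsDyadicCube n Q → P ⊆ Q → Q ⊆ Q₀ → ε P ≤ ε Q)
    (p : (Fin n → ℝ) → ℝ) (hpMeas : Measurable p) (hp1 : ∀ x, 1 ≤ p x)
    (hpminus : 1 < essInf p (volume.restrict Q₀))
    (hpplus : ∃ B : ℝ, ∀ᵐ x ∂volume.restrict Q₀, p x ≤ B)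
    (hLH0 : ∃ C0 : ℝ, 0 < C0 ∧ ∀ Q, IsDyadicCube n Q → Q ⊆ Q₀ →
      ((volume Q).toReal / ε Q) ^
        (essInf p (volume.restrict Q) - essSup p (volume.restrict Q)) ≤ C0) :
    ∃ C : ℝ, 0 < C ∧ ∀ f : (Fin n → ℝ) → ℝ, Measurable f →
      MemVarLp p (volume.restrict Q₀) f →
      varLpNorm p (volume.restrict Q₀) (epsMaxOn n Q₀ ε f) ≤
        ENNReal.ofReal C * varLpNorm p (volume.restrict Q₀) f := by
  obtain ⟨K, hK, hbound⟩ := exists_lintegral_epsMaxOn_le n Q₀ hQ₀ ε hεpos hεbdd p hpMeas hp1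
    hpminus hpplus hLH0
  set C : ℝ := max 1 K.toReal
  have hC1 : 1 ≤ C := le_max_left _ _
  have hC0 : 0 < C := by linarith
  refine ⟨C, hC0, fun f hf _ => varLpNorm_le_mul hC0 fun l hl hle => ?_⟩
  have hscale (a t : ℝ) (ht : 1 ≤ t) :
      ENNReal.ofReal ((|a| / (C * l)) ^ t) ≤
        ENNReal.ofReal C⁻¹ * ENNReal.ofReal ((|a| / l) ^ t) := by
    rw [← ENNReal.ofReal_mul (by positivity)]
    refine ENNReal.ofReal_le_ofReal ?_
    have : |a| / (C * l) = C⁻¹ * (|a| / l) := by field_simp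
    rw [this, Real.mul_rpow (by positivity) (by positivity)]
    gcongr
    exact Real.rpow_le_self_of_le_one (by positivity) (inv_le_one_of_one_le₀ hC1) ht
  calc _ ≤ ∫⁻ x in Q₀, ENNReal.ofReal C⁻¹ *
        ENNReal.ofReal ((|epsMaxOn n Q₀ ε f x| / l) ^ p x) :=
        lintegral_mono fun x => hscale _ _ (hp1 x)
    _ = ENNReal.ofReal C⁻¹ * ∫⁻ x in Q₀,
        ENNReal.ofReal ((|epsMaxOn n Q₀ ε f x| / l) ^ p x) :=
        lintegral_const_mul' _ _ ENNReal.ofReal_ne_top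
    _ ≤ ENNReal.ofReal C⁻¹ * ENNReal.ofReal C := by
        gcongr
        exact (hbound f hf l hl hle).trans
          ((ENNReal.le_ofReal_iff_toReal_le hK hC0.le).2 (le_max_right _ _))
    _ = 1 := by
        rw [← ENNReal.ofReal_mul (by positivity), inv_mul_cancel₀ hC0.ne', ENNReal.ofReal_one]
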